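/- Suppose nodes 1, 2 ∈ V satisfy 𝒩'_1 ⊆ 𝒩'_2, and fix the infection initialization R and the parameters Δ. Given a curing initialization B, define B* by B*_1 = 0, B*_2 = B_1 + B_2, and B*_k = B_k for all k ∉ {1,2}. Then for every n ≥ 1, Ĩ_n(B*, R) ≤ Ĩ_n(B, R). Hence, when minimizing the average infection rate Ĩ_n over curing initializations, a node whose closed neighborhood is nested in another node's closed neighborhood may be assumed to receive no black balls. -/

import Mathlib

open Finset

noncomputable section

namespace Polya

variable {N : ℕ}

/-- Closed neighborhood of node `i`. -/
def nbhd (G : SimpleGraph (Fin N)) [DecidableRel G.Adj] (i : Fin N) : Finset (Fin N) :=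
  insert i (G.neighborFinset i)

/-- Super-urn count of a vector `x` at node `i`. -/
def bar (G : SimpleGraph (Fin N)) [DecidableRel G.Adj] (x : Fin N → ℝ) (i : Fin N) : ℝ :=
  ∑ j ∈ nbhd G i, x j

/-- Super-urn proportion of node `i` after `n` draws with history `a`
(`a j t` is the draw of node `j` at time `t+1`). -/
def S (G : SimpleGraph (Fin N)) [DecidableRel G.Adj] (B R : Fin N → ℝ)
    (Δr Δb : Fin N → ℕ → ℝ) (n : ℕ) (a : Fin N → ℕ → Bool) (i : Fin N) : ℝ :=
  (bar G R i + ∑ j ∈ nbhd G i, ∑ t ∈ Finset.range n, if a j t then Δr j t else 0) /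
    (bar G R i + bar G B i +
      ∑ j ∈ nbhd G i, ∑ t ∈ Finset.range n, if a j t then Δr j t else Δb j t)

/-- Extension of a finite draw history to an `ℕ`-indexed one. -/
def ext (n : ℕ) (a : Fin N → Fin n → Bool) : Fin N → ℕ → Bool :=
  fun j t => if h : t < n then a j ⟨t, h⟩ else false

/-- Joint probability of the draw history `a` over the first `n` draws. -/
def Pjoint (G : SimpleGraph (Fin N)) [DecidableRel G.Adj] (B R : Fin N → ℝ)
    (Δr Δb : Fin N → ℕ → ℝ) (n : ℕ) (a : Fin N → ℕ → Bool) : ℝ :=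
  ∏ t ∈ Finset.range n, ∏ i : Fin N,
    if a i t then S G B R Δr Δb t a i else 1 - S G B R Δr Δb t a i

/-- Average infection rate at time `n` (for `n ≥ 1`). -/
def Itilde (G : SimpleGraph (Fin N)) [DecidableRel G.Adj] (B R : Fin N → ℝ)
    (Δr Δb : Fin N → ℕ → ℝ) (n : ℕ) : ℝ :=
  (1 / (N : ℝ)) * ∑ i : Fin N, ∑ a : Fin N → Fin (n - 1) → Bool,
    S G B R Δr Δb (n - 1) (ext (n - 1) a) i * Pjoint G B R Δr Δb (n - 1) (ext (n - 1) a)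

theorem bern_mono : ∀ (m : ℕ) (f f' : (Fin m → Bool) → ℝ) (s s' : Fin m → ℝ),
    Monotone f → (∀ c, f c ≤ f' c) → (∀ i, 0 ≤ s i) → (∀ i, s i ≤ s' i) → (∀ i, s' i ≤ 1) →
    ∑ c, f c * ∏ i, (if c i then s i else 1 - s i) ≤
      ∑ c, f' c * ∏ i, (if c i then s' i else 1 - s' i) := by
  intro m
  induction m with
  | zero =>
    intro f f' s s' _ h _ _ _
    simpa using h _
  | succ m ih =>
    intro f f' s s' hf h h0 h1 h2
    have key : ∀ (f : (Fin (m+1) → Bool) → ℝ) (s : Fin (m+1) → ℝ),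
        ∑ c, f c * ∏ i, (if c i then s i else 1 - s i) =
        s 0 * (∑ c : Fin m → Bool, f (Fin.cons true c) *
            ∏ i, (if c i then s i.succ else 1 - s i.succ)) +
        (1 - s 0) * (∑ c : Fin m → Bool, f (Fin.cons false c) *
            ∏ i, (if c i then s i.succ else 1 - s i.succ)) := by
      intro f s
      rw [← (Fin.consEquiv (fun _ : Fin (m+1) => Bool)).sum_comp, Fintype.sum_prod_type,
        Fintype.sum_bool, Finset.mul_sum, Finset.mul_sum]
      congr 1
      · refine Finset.sum_congr rfl fun c _ => ?_
        simp [Fin.consEquiv, Fin.prod_univ_succ]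
        ring
      · refine Finset.sum_congr rfl fun c _ => ?_
        simp [Fin.consEquiv, Fin.prod_univ_succ]
        ring
    rw [key, key]
    have hm : ∀ b : Bool, Monotone (fun c : Fin m → Bool => f (Fin.cons b c)) := by
      intro b c d hcd
      exact hf (Fin.cons_le_cons.2 ⟨le_refl _, hcd⟩)
    have e1 := ih (fun c => f (Fin.cons true c)) (fun c => f' (Fin.cons true c))
      (fun i => s i.succ) (fun i => s' i.succ) (hm true) (fun c => h _) (fun i => h0 _)
      (fun i => h1 _) (fun i => h2 _)
    have e2 := ih (fun c => f (Fin.cons false c)) (fun c => f' (Fin.cons false c))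
      (fun i => s i.succ) (fun i => s' i.succ) (hm false) (fun c => h _) (fun i => h0 _)
      (fun i => h1 _) (fun i => h2 _)
    have e3 := ih (fun c => f (Fin.cons false c)) (fun c => f (Fin.cons true c))
      (fun i => s i.succ) (fun i => s i.succ) (hm false)
      (fun c => hf (Fin.cons_le_cons.2 ⟨by simp, le_refl _⟩)) (fun i => h0 _)
      (fun i => le_refl _) (fun i => (h1 _).trans (h2 _))
    have e4 := ih (fun c => f (Fin.cons true c)) (fun c => f (Fin.cons true c))
      (fun i => s i.succ) (fun i => s i.succ) (hm true)
      (fun c => le_refl _) (fun i => h0 _)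
      (fun i => le_refl _) (fun i => (h1 _).trans (h2 _))
    have a0 := h0 0
    have a1 := h1 0
    have a2 := h2 0
    generalize (∑ c : Fin m → Bool, f (Fin.cons true c) * ∏ i, (if c i then s i.succ else 1 - s i.succ)) = X at *
    generalize (∑ c : Fin m → Bool, f (Fin.cons false c) * ∏ i, (if c i then s i.succ else 1 - s i.succ)) = Y at *
    nlinarith [mul_nonneg (sub_nonneg.2 a1) (sub_nonneg.2 e3),
      mul_nonneg (a0.trans a1) (sub_nonneg.2 e1),
      mul_nonneg (sub_nonneg.2 a2) (sub_nonneg.2 e2)]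

def upd (n : ℕ) (a : Fin N → ℕ → Bool) (c : Fin N → Bool) : Fin N → ℕ → Bool :=
  fun j t => if t = n then c j else a j t

def EE (G : SimpleGraph (Fin N)) [DecidableRel G.Adj] (B R : Fin N → ℝ)
    (Δr Δb : Fin N → ℕ → ℝ) (n : ℕ) (F : (Fin N → ℕ → Bool) → ℝ) : ℝ :=
  ∑ a : Fin N → Fin n → Bool, F (ext n a) * Pjoint G B R Δr Δb n (ext n a)

theorem S_congr (G : SimpleGraph (Fin N)) [DecidableRel G.Adj] (B R : Fin N → ℝ)
    (Δr Δb : Fin N → ℕ → ℝ) (n : ℕ) (a a' : Fin N → ℕ → Bool)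
    (h : ∀ j, ∀ t < n, a j t = a' j t) (i : Fin N) :
    S G B R Δr Δb n a i = S G B R Δr Δb n a' i := by
  unfold S
  congr 2
  · refine Finset.sum_congr rfl fun j _ => Finset.sum_congr rfl fun t ht => ?_
    rw [h j t (Finset.mem_range.1 ht)]
  · refine Finset.sum_congr rfl fun j _ => Finset.sum_congr rfl fun t ht => ?_
    rw [h j t (Finset.mem_range.1 ht)]

theorem P_congr (G : SimpleGraph (Fin N)) [DecidableRel G.Adj] (B R : Fin N → ℝ)
    (Δr Δb : Fin N → ℕ → ℝ) (n : ℕ) (a a' : Fin N → ℕ → Bool)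
    (h : ∀ j, ∀ t < n, a j t = a' j t) :
    Pjoint G B R Δr Δb n a = Pjoint G B R Δr Δb n a' := by
  unfold Pjoint
  refine Finset.prod_congr rfl fun t ht => Finset.prod_congr rfl fun i _ => ?_
  have ht := Finset.mem_range.1 ht
  rw [h i t ht, S_congr G B R Δr Δb t a a' (fun j u hu => h j u (hu.trans ht))]

def splitE (n : ℕ) : ((Fin N → Fin n → Bool) × (Fin N → Bool)) ≃ (Fin N → Fin (n+1) → Bool) where
  toFun x := fun j => Fin.snoc (α := fun _ => Bool) (x.1 j) (x.2 j)
  invFun y := (fun j => Fin.init (y j), fun j => y j (Fin.last n))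
  left_inv x := by simp
  right_inv y := by simp

theorem ext_split (n : ℕ) (a : Fin N → Fin n → Bool) (c : Fin N → Bool) :
    ext (n+1) (splitE n (a, c)) = upd n (ext n a) c := by
  funext j t
  simp only [ext, upd, splitE, Equiv.coe_fn_mk, Fin.snoc]
  by_cases h : t = n
  · subst h; simp
  · by_cases h2 : t < n
    · have : t < n + 1 := by omega
      simp [h, h2, this]
    · have : ¬ t < n + 1 := by omega
      simp [h, h2, this]

theorem EE_succ (G : SimpleGraph (Fin N)) [DecidableRel G.Adj] (B R : Fin N → ℝ)
    (Δr Δb : Fin N → ℕ → ℝ) (n : ℕ) (F : (Fin N → ℕ → Bool) → ℝ) :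
    EE G B R Δr Δb (n+1) F = EE G B R Δr Δb n (fun a => ∑ c : Fin N → Bool,
      F (upd n a c) * ∏ i, (if c i then S G B R Δr Δb n a i else 1 - S G B R Δr Δb n a i)) := by
  unfold EE
  rw [← (splitE n).sum_comp, Fintype.sum_prod_type]
  refine Finset.sum_congr rfl fun a _ => ?_
  rw [Finset.sum_mul]
  refine Finset.sum_congr rfl fun c _ => ?_
  rw [ext_split]
  have hh : ∀ j, ∀ t < n, upd n (ext n a) c j t = ext n a j t := by
    intro j t ht
    simp [upd, ht.ne]
  have : Pjoint G B R Δr Δb (n+1) (upd n (ext n a) c) =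
      Pjoint G B R Δr Δb n (ext n a) *
      ∏ i, (if c i then S G B R Δr Δb n (ext n a) i else 1 - S G B R Δr Δb n (ext n a) i) := by
    rw [← P_congr G B R Δr Δb n _ _ hh]
    conv_lhs => rw [Pjoint, Finset.prod_range_succ]
    rw [Pjoint]
    congr 1
    refine Finset.prod_congr rfl fun i _ => ?_
    rw [S_congr G B R Δr Δb n _ _ hh]
    simp [upd]
  rw [this]; ring

theorem frac_mono {x b y c : ℝ} (hx : 0 ≤ x) (hc : 0 ≤ c) (hxy : x ≤ y) (hcb : c ≤ b)
    (h1 : 0 < x + b) (h2 : 0 < y + c) : x / (x + b) ≤ y / (y + c) := by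
  rw [div_le_div_iff₀ h1 h2]
  nlinarith [mul_le_mul hxy hcb hc (hx.trans hxy)]

theorem S_eq (G : SimpleGraph (Fin N)) [DecidableRel G.Adj] (B R : Fin N → ℝ)
    (Δr Δb : Fin N → ℕ → ℝ) (n : ℕ) (a : Fin N → ℕ → Bool) (i : Fin N) :
    S G B R Δr Δb n a i =
    (bar G R i + ∑ j ∈ nbhd G i, ∑ t ∈ Finset.range n, if a j t then Δr j t else 0) /
    ((bar G R i + ∑ j ∈ nbhd G i, ∑ t ∈ Finset.range n, if a j t then Δr j t else 0) +
     (bar G B i + ∑ j ∈ nbhd G i, ∑ t ∈ Finset.range n, if a j t then 0 else Δb j t)) := by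
  unfold S
  congr 1
  have : (∑ j ∈ nbhd G i, ∑ t ∈ Finset.range n, if a j t then Δr j t else Δb j t) =
    (∑ j ∈ nbhd G i, ∑ t ∈ Finset.range n, if a j t then Δr j t else 0) +
    (∑ j ∈ nbhd G i, ∑ t ∈ Finset.range n, if a j t then 0 else Δb j t) := by
    simp only [← Finset.sum_add_distrib]
    refine Finset.sum_congr rfl fun j _ => Finset.sum_congr rfl fun t ht => ?_
    split_ifs <;> simp
  rw [this]; ring

set_option linter.unusedSectionVars false
section
variable (G : SimpleGraph (Fin N)) [DecidableRel G.Adj] (B B' R : Fin N → ℝ)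
    (Δr Δb : Fin N → ℕ → ℝ) (hΔr : ∀ j t, 0 ≤ Δr j t) (hΔb : ∀ j t, 0 ≤ Δb j t)
    (hR : ∀ i, 0 ≤ bar G R i) (hB : ∀ i, 0 ≤ bar G B i)
    (hpos : ∀ i, 0 < bar G R i + bar G B i) (hBB : ∀ i, bar G B i ≤ bar G B' i)

theorem red_nonneg (hΔr : ∀ j t, 0 ≤ Δr j t) (n : ℕ) (a : Fin N → ℕ → Bool) (i : Fin N) :
    0 ≤ ∑ j ∈ nbhd G i, ∑ t ∈ Finset.range n, if a j t then Δr j t else 0 := by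
  refine Finset.sum_nonneg fun j _ => Finset.sum_nonneg fun t _ => ?_
  split_ifs
  · exact hΔr j t
  · exact le_refl _

theorem black_nonneg (hΔb : ∀ j t, 0 ≤ Δb j t) (n : ℕ) (a : Fin N → ℕ → Bool) (i : Fin N) :
    0 ≤ ∑ j ∈ nbhd G i, ∑ t ∈ Finset.range n, if a j t then 0 else Δb j t := by
  refine Finset.sum_nonneg fun j _ => Finset.sum_nonneg fun t _ => ?_
  split_ifs
  · exact le_refl _
  · exact hΔb j t

include hΔr hΔb hR hB hpos

theorem S_nonneg (n : ℕ) (a : Fin N → ℕ → Bool) (i : Fin N) : 0 ≤ S G B R Δr Δb n a i := by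
  rw [S_eq]
  have := red_nonneg G Δr hΔr n a i
  have := black_nonneg G Δb hΔb n a i
  have := hR i
  have := hB i
  positivity

theorem S_le_one (n : ℕ) (a : Fin N → ℕ → Bool) (i : Fin N) : S G B R Δr Δb n a i ≤ 1 := by
  rw [S_eq]
  have := red_nonneg G Δr hΔr n a i
  have := black_nonneg G Δb hΔb n a i
  have := hR i
  have := hB i
  apply div_le_one_of_le₀ <;> linarith

include hBB

theorem S_mono (n : ℕ) (a a' : Fin N → ℕ → Bool) (haa : a ≤ a') (i : Fin N) :
    S G B' R Δr Δb n a i ≤ S G B R Δr Δb n a' i := by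
  rw [S_eq, S_eq]
  have h1 := red_nonneg G Δr hΔr n a i
  have h2 := black_nonneg G Δb hΔb n a i
  have h1' := red_nonneg G Δr hΔr n a' i
  have h2' := black_nonneg G Δb hΔb n a' i
  have h3 := hR i
  have h4 := hB i
  have h5 := hpos i
  have h6 := hBB i
  have r : (∑ j ∈ nbhd G i, ∑ t ∈ Finset.range n, if a j t then Δr j t else 0) ≤
      ∑ j ∈ nbhd G i, ∑ t ∈ Finset.range n, if a' j t then Δr j t else 0 := by
    refine Finset.sum_le_sum fun j _ => Finset.sum_le_sum fun t _ => ?_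
    have hi : a j t = true → a' j t = true := haa j t
    have := hΔr j t
    cases h : a j t <;> cases h' : a' j t <;> simp_all
  have b : (∑ j ∈ nbhd G i, ∑ t ∈ Finset.range n, if a' j t then 0 else Δb j t) ≤
      ∑ j ∈ nbhd G i, ∑ t ∈ Finset.range n, if a j t then 0 else Δb j t := by
    refine Finset.sum_le_sum fun j _ => Finset.sum_le_sum fun t _ => ?_
    have hi : a j t = true → a' j t = true := haa j t
    have := hΔb j t
    cases h : a j t <;> cases h' : a' j t <;> simp_all
  apply frac_mono <;> linarith

theorem EE_mono (n : ℕ) : ∀ (F F' : (Fin N → ℕ → Bool) → ℝ), Monotone F' → (∀ a, F a ≤ F' a) →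
    EE G B' R Δr Δb n F ≤ EE G B R Δr Δb n F' := by
  have hB' : ∀ i, 0 ≤ bar G B' i := fun i => (hB i).trans (hBB i)
  have hpos' : ∀ i, 0 < bar G R i + bar G B' i := fun i => by linarith [hpos i, hBB i]
  induction n with
  | zero =>
    intro F F' _ h
    simp [EE, Pjoint]
    exact h _
  | succ n ih =>
    intro F F' hF h
    rw [EE_succ, EE_succ]
    have hu : ∀ a, Monotone (fun c => F' (upd n a c)) := by
      intro a c d hcd
      refine hF fun j t => ?_
      by_cases ht : t = n
      · simpa [upd, ht] using hcd j
      · simp [upd, ht]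
    apply ih
    · intro a a' haa
      refine bern_mono N _ _ _ _ (hu a) (fun c => hF fun j t => ?_)
        (S_nonneg G B R Δr Δb hΔr hΔb hR hB hpos n a)
        (S_mono G B B R Δr Δb hΔr hΔb hR hB hpos (fun _ => le_refl _) n a a' haa)
        (S_le_one G B R Δr Δb hΔr hΔb hR hB hpos n a')
      by_cases ht : t = n
      · simp [upd, ht]
      · simpa [upd, ht] using haa j t
    · intro a
      refine le_trans (Finset.sum_le_sum fun c _ => mul_le_mul_of_nonneg_right (h _) ?_)
        (bern_mono N _ _ _ _ (hu a) (fun c => le_refl _)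
        (S_nonneg G B' R Δr Δb hΔr hΔb hR hB' hpos' n a)
        (S_mono G B B' R Δr Δb hΔr hΔb hR hB hpos hBB n a a (le_refl _))
        (S_le_one G B R Δr Δb hΔr hΔb hR hB hpos n a))
      refine Finset.prod_nonneg fun i _ => ?_
      split_ifs
      · exact S_nonneg G B' R Δr Δb hΔr hΔb hR hB' hpos' n a i
      · exact sub_nonneg.2 (S_le_one G B' R Δr Δb hΔr hΔb hR hB' hpos' n a i)

end

theorem bar_le (G : SimpleGraph (Fin N)) [DecidableRel G.Adj]
    (p q : Fin N) (hpq : p ≠ q) (hsub : nbhd G p ⊆ nbhd G q)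
    (B : Fin N → ℝ) (hB : ∀ j, 0 ≤ B j) (i : Fin N) :
    bar G B i ≤ bar G (fun k => if k = p then 0 else if k = q then B p + B q else B k) i := by
  have hsym : ∀ i j : Fin N, i ∈ nbhd G j ↔ j ∈ nbhd G i := by
    intro i j
    simp [nbhd, G.adj_comm, eq_comm]
  have e : ∀ k, (if k = p then 0 else if k = q then B p + B q else B k) =
      B k + ((if k = q then B p else 0) - (if k = p then B p else 0)) := by
    intro k
    by_cases h1 : k = p
    · subst h1; simp [hpq]
    · by_cases h2 : k = q
      · subst h2; simp [h1]; ring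
      · simp [h1, h2]
  unfold bar
  simp only [e]
  rw [Finset.sum_add_distrib, Finset.sum_sub_distrib, Finset.sum_ite_eq', Finset.sum_ite_eq']
  by_cases h : p ∈ nbhd G i
  · have : q ∈ nbhd G i := (hsym _ _).1 (hsub ((hsym _ _).1 h))
    simp [h, this]
  · have := hB p
    simp only [h, if_false]
    split_ifs <;> linarith

/-- if node `p`'s closed neighborhood is nested in node `q`'s,
moving all black balls of `p` to `q` does not increase the average infection
rate `Ĩ_n`, for every `n ≥ 1`. -/
theorem outer_node_no_black_balls_general (hN : 1 ≤ N)
    (G : SimpleGraph (Fin N)) [DecidableRel G.Adj]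
    (p q : Fin N) (hpq : p ≠ q) (hsub : nbhd G p ⊆ nbhd G q)
    (R : Fin N → ℝ) (hR : ∀ j, 0 ≤ R j)
    (B : Fin N → ℝ) (hB : ∀ j, 0 ≤ B j)
    (hpos : ∀ i, 0 < bar G R i + bar G B i)
    (Δr Δb : Fin N → ℕ → ℝ) (hΔr : ∀ j t, 0 ≤ Δr j t) (hΔb : ∀ j t, 0 ≤ Δb j t) :
    ∀ n, 1 ≤ n →
      Itilde G (fun k => if k = p then 0 else if k = q then B p + B q else B k) R Δr Δb n
        ≤ Itilde G B R Δr Δb n := by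
  intro n _
  have hR' : ∀ i, 0 ≤ bar G R i := fun i => Finset.sum_nonneg fun j _ => hR j
  have hB' : ∀ i, 0 ≤ bar G B i := fun i => Finset.sum_nonneg fun j _ => hB j
  have hBB := bar_le G p q hpq hsub B hB
  unfold Itilde
  refine mul_le_mul_of_nonneg_left (Finset.sum_le_sum fun i _ => ?_) (by positivity)
  exact EE_mono G B _ R Δr Δb hΔr hΔb hR' hB' hpos hBB (n-1)
    (fun a => S G _ R Δr Δb (n-1) a i) (fun a => S G B R Δr Δb (n-1) a i)
    (fun a a' haa => S_mono G B B R Δr Δb hΔr hΔb hR' hB' hpos (fun _ => le_refl _) _ a a' haa i)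
    (fun a => S_mono G B _ R Δr Δb hΔr hΔb hR' hB' hpos hBB _ a a (le_refl _) i)

end Polya
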